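/- Let (G,S) be an essential set-equipped graph. The S-graph shift X(G,S) is sofic if and only if the difference sequence Δ(S_v) is eventually periodic for every vertex v ∈ V(G). -/

import Mathlib

open Filter Topology

/-- The shift map on bi-infinite sequences over the alphabet `A`. -/
def shiftMap {A : Type*} (x : ℤ → A) : ℤ → A := fun i => x (i + 1)

/-- A finite word `w` appears (as a consecutive subsequence) in the bi-infinite
sequence `x`. -/
def Appears {A : Type*} (w : List A) (x : ℤ → A) : Prop :=
  ∃ k : ℤ, ∀ i : Fin w.length, x (k + (i : ℕ)) = w.get i

/-- `w` belongs to the language of `X`: it appears in some point of `X`. -/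
def InLanguage {A : Type*} (X : Set (ℤ → A)) (w : List A) : Prop :=
  ∃ x ∈ X, Appears w x

/-- `X` has topological entropy `h`, i.e. `(1/n) · log |B_n(X)| → h`. -/
def HasEntropy {A : Type*} (X : Set (ℤ → A)) (h : ℝ) : Prop :=
  Filter.Tendsto
    (fun n : ℕ => Real.log ({w : List A | w.length = n ∧ InLanguage X w}.ncard) / n)
    Filter.atTop (nhds h)

/-- The set of bi-infinite concatenations `⋯ u₋₁^{n₋₁} u₀^{n₀} u₁^{n₁} ⋯` with
`uᵢ ∈ V`, `nᵢ ∈ S uᵢ` and `(uᵢ, uᵢ₊₁)` an edge of the graph.  The `S`-graph shift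
`X(G,S)` is the closure of this set. -/
def SGraphCore {V : Type*} (Adj : V → V → Prop) (S : V → Set ℕ) : Set (ℤ → V) :=
  {x | ∃ (a : ℤ → V) (t : ℤ → ℤ), StrictMono t ∧
    (∀ i : ℤ, (t (i + 1) - t i).toNat ∈ S (a i)) ∧
    (∀ i : ℤ, Adj (a i) (a (i + 1))) ∧
    (∀ i k : ℤ, t i ≤ k → k < t (i + 1) → x k = a i) ∧
    (∀ m : ℤ, ∃ i : ℤ, t i ≤ m ∧ m < t (i + 1))}

/-- `X` is a subshift of finite type. -/
def IsSFT {A : Type*} (X : Set (ℤ → A)) : Prop :=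
  ∃ F : Set (List A), F.Finite ∧ X = {x | ∀ w ∈ F, ¬ Appears w x}

/-- `X` is sofic: the image of a subshift of finite type under a continuous
shift-commuting map. -/
def IsSofic {A : Type*} [TopologicalSpace A] (X : Set (ℤ → A)) : Prop :=
  ∃ (m : ℕ) (Y : Set (ℤ → Fin m)) (φ : (ℤ → Fin m) → (ℤ → A)),
    IsSFT Y ∧ ContinuousOn φ Y ∧ (∀ y ∈ Y, φ (shiftMap y) = shiftMap (φ y)) ∧
    X = φ '' Y

/-- The difference sequence `Δ(S)` of `S ⊆ ℕ` is eventually periodic; equivalently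
(as used in the paper), there are `d > 0` and `N` with `n ∈ S ↔ n + d ∈ S` for
every `n ≥ N`. -/
def DeltaEventuallyPeriodic (S : Set ℕ) : Prop :=
  ∃ d : ℕ, 0 < d ∧ ∃ N : ℕ, ∀ n ≥ N, (n ∈ S ↔ n + d ∈ S)

section Topological

variable {A : Type*}

/-- A point lies in the closure of `X` iff it agrees on every finite window with a point of `X`. -/
theorem mem_closure_iff_forall_window [TopologicalSpace A] [DiscreteTopology A]
    {X : Set (ℤ → A)} {x : ℤ → A} :
    x ∈ closure X ↔ ∀ r : ℕ, ∃ z ∈ X, ∀ i : ℤ, |i| ≤ r → z i = x i := by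
  constructor
  · intro hx r
    have hopen : IsOpen (Set.pi (Set.Icc (-(r : ℤ)) r) fun i => ({x i} : Set A)) :=
      isOpen_set_pi (Set.finite_Icc _ _) fun i _ => isOpen_discrete _
    obtain ⟨z, hz, hzX⟩ := mem_closure_iff.1 hx _ hopen fun i _ => rfl
    exact ⟨z, hzX, fun i hi => hz i (abs_le.1 hi)⟩
  · intro h
    refine mem_closure_iff.2 fun U hU hxU => ?_
    obtain ⟨I, u, hu, hsub⟩ := isOpen_pi_iff.1 hU x hxU
    obtain ⟨z, hzX, hz⟩ := h (I.sup Int.natAbs)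
    refine ⟨z, hsub fun i hi => ?_, hzX⟩
    have hle : i.natAbs ≤ I.sup Int.natAbs := Finset.le_sup (f := Int.natAbs) hi
    rw [hz i (by rw [Int.abs_eq_natAbs]; exact_mod_cast hle)]
    exact (hu i hi).2

theorem isClosed_of_isSFT [TopologicalSpace A] [DiscreteTopology A] {Y : Set (ℤ → A)}
    (hY : IsSFT Y) : IsClosed Y := by
  obtain ⟨F, -, rfl⟩ := hY
  simp only [Set.ofPred_forall]
  refine isClosed_iInter fun w => isClosed_iInter fun _ => isOpen_compl_iff.1 ?_
  simp only [Set.compl_ofPred, not_not, Appears, Set.ofPred_exists, Set.ofPred_forall]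
  refine isOpen_iUnion fun k => isOpen_iInter_of_finite fun i => ?_
  have hc : Continuous fun x : ℤ → A => x (k + (i : ℕ)) := continuous_apply _
  exact (isOpen_discrete {w.get i}).preimage hc

/-- The local rule of a continuous map on a closed set has a finite window. -/
theorem exists_window_of_continuousOn {m : ℕ} [TopologicalSpace A] [DiscreteTopology A]
    {Y : Set (ℤ → Fin m)} (hY : IsClosed Y) {φ : (ℤ → Fin m) → ℤ → A} (hφ : ContinuousOn φ Y) :
    ∃ r : ℕ, ∀ y ∈ Y, ∀ z ∈ Y, (∀ i : ℤ, |i| ≤ r → z i = y i) → φ z 0 = φ y 0 := by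
  have hloc : ∀ y ∈ Y, ∃ r : ℕ, ∀ z ∈ Y, (∀ i : ℤ, |i| ≤ r → z i = y i) → φ z 0 = φ y 0 := by
    intro y hy
    have hc : ContinuousOn (fun z => φ z 0) Y := (continuous_apply (0 : ℤ)).comp_continuousOn hφ
    have hn : {z | φ z 0 = φ y 0} ∈ 𝓝[Y] y :=
      (hc y hy).preimage_mem_nhdsWithin (IsOpen.mem_nhds (isOpen_discrete {φ y 0}) rfl)
    obtain ⟨U, hU, hyU, hsub⟩ := mem_nhdsWithin.1 hn
    obtain ⟨I, u, hu, hI⟩ := isOpen_pi_iff.1 hU y hyU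
    refine ⟨I.sup Int.natAbs, fun z hz hzy => hsub ⟨hI fun i hi => ?_, hz⟩⟩
    have hle : i.natAbs ≤ I.sup Int.natAbs := Finset.le_sup (f := Int.natAbs) hi
    rw [hzy i (by rw [Int.abs_eq_natAbs]; exact_mod_cast hle)]
    exact (hu i hi).2
  choose! r hr using hloc
  let C : (ℤ → Fin m) → Set (ℤ → Fin m) := fun y =>
    Set.pi (Set.Icc (-(r y : ℤ)) (r y)) fun i => {y i}
  have hC : ∀ y ∈ Y, C y ∈ 𝓝 y := fun y _ =>
    (isOpen_set_pi (Set.finite_Icc _ _) fun i _ => isOpen_discrete _).mem_nhds fun i _ => rfl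
  obtain ⟨T, hTY, hT⟩ := hY.isCompact.elim_nhds_subcover C hC
  refine ⟨T.sup r, fun y hy z hz hzy => ?_⟩
  obtain ⟨p, hpT, hyp⟩ := Set.mem_iUnion₂.1 (hT hy)
  have hle : (r p : ℤ) ≤ (T.sup r : ℕ) := by exact_mod_cast Finset.le_sup (f := r) hpT
  have h1 : φ y 0 = φ p 0 := hr p (hTY p hpT) y hy fun i hi => hyp i (abs_le.1 hi)
  have h2 : φ z 0 = φ p 0 := hr p (hTY p hpT) z hz fun i hi =>
    (hzy i (hi.trans hle)).trans (hyp i (abs_le.1 hi))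
  rw [h1, h2]

end Topological

section Presentation

variable {A Q : Type*}

/-- `s` is a bi-infinite path for the transition relation `E`. -/
def IsPath (E : Q → Q → Prop) (s : ℤ → Q) : Prop := ∀ i, E (s i) (s (i + 1))

/-- The set of label sequences of bi-infinite paths of a vertex-labelled graph. -/
def labelShift (E : Q → Q → Prop) (l : Q → A) : Set (ℤ → A) :=
  {x | ∃ s, IsPath E s ∧ ∀ i, x i = l (s i)}

theorem IsPath.translate {E : Q → Q → Prop} {s : ℤ → Q} (hs : IsPath E s) (k : ℤ) :
    IsPath E fun i => s (i + k) := fun i => by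
  have := hs (i + k)
  rwa [add_right_comm] at this

theorem IsPath.glue {E : Q → Q → Prop} {s s' : ℤ → Q} (hs : IsPath E s) (hs' : IsPath E s')
    {n : ℤ} (h : s n = s' n) : IsPath E fun i => if i ≤ n then s i else s' i := by
  intro i
  rcases lt_trichotomy i n with hi | rfl | hi
  · simpa [hi.le, Int.add_one_le_iff.2 hi] using hs i
  · simpa [h] using hs' i
  · simpa [not_le.2 hi, not_le.2 (hi.trans (lt_add_one i))] using hs' i

theorem isSFT_setOf_isPath [Finite Q] (E : Q → Q → Prop) : IsSFT {s : ℤ → Q | IsPath E s} := by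
  refine ⟨(fun p : Q × Q => [p.1, p.2]) '' {p | ¬ E p.1 p.2}, (Set.toFinite _).image _, ?_⟩
  ext s
  simp only [Set.mem_ofPred_eq, Set.forall_mem_image, Prod.forall]
  constructor
  · rintro hs a b hab ⟨k, hk⟩
    have h0 := hk ⟨0, by simp⟩
    have h1 := hk ⟨1, by simp⟩
    simp only [List.get_eq_getElem, List.getElem_cons_zero, List.getElem_cons_succ,
      Nat.cast_zero, add_zero, Nat.cast_one] at h0 h1
    exact hab (h0 ▸ h1 ▸ hs k)
  · intro h i
    by_contra hE
    refine h _ _ hE ⟨i, fun j => ?_⟩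
    match j with
    | ⟨0, _⟩ => simp
    | ⟨1, _⟩ => simp

theorem labelShift_eq_of_equiv {Q' : Type*} (e : Q ≃ Q') (E : Q → Q → Prop) (l : Q → A) :
    labelShift E l = labelShift (fun p q => E (e.symm p) (e.symm q)) (l ∘ e.symm) := by
  ext x
  constructor
  · rintro ⟨s, hs, hx⟩
    exact ⟨e ∘ s, fun i => by simpa using hs i, fun i => by simpa using hx i⟩
  · rintro ⟨s, hs, hx⟩
    exact ⟨e.symm ∘ s, hs, hx⟩

theorem isSofic_labelShift [TopologicalSpace A] [Finite Q] (E : Q → Q → Prop) (l : Q → A) :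
    IsSofic (labelShift E l) := by
  rw [labelShift_eq_of_equiv (Finite.equivFin Q)]
  generalize (fun p q => E ((Finite.equivFin Q).symm p) ((Finite.equivFin Q).symm q)) = E',
    l ∘ (Finite.equivFin Q).symm = l'
  refine ⟨Nat.card Q, _, fun y i => l' (y i), isSFT_setOf_isPath E',
    Continuous.continuousOn ?_, fun y _ => rfl, ?_⟩
  · exact continuous_pi fun i => continuous_of_discreteTopology.comp (continuous_apply i)
  · ext x
    simp only [labelShift, Set.mem_ofPred_eq, Set.mem_image, funext_iff, eq_comm]

theorem IsSofic.isClosed [TopologicalSpace A] [T2Space A] {X : Set (ℤ → A)} (hX : IsSofic X) :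
    IsClosed X := by
  obtain ⟨m, Y, φ, hY, hφ, -, rfl⟩ := hX
  exact ((isClosed_of_isSFT hY).isCompact.image_of_continuousOn hφ).isClosed

theorem Appears.translate {w : List A} {x : ℤ → A} {k : ℤ}
    (h : Appears w fun i => x (i + k)) : Appears w x := by
  obtain ⟨j, hj⟩ := h
  exact ⟨j + k, fun i => by rw [← hj i]; congr 1; ring⟩

/-- Every sofic shift is the label shift of a finite vertex-labelled graph. -/
theorem IsSofic.exists_labelShift [TopologicalSpace A] [DiscreteTopology A]
    {X : Set (ℤ → A)} (hX : IsSofic X) :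
    ∃ (Q : Type) (_ : Finite Q) (E : Q → Q → Prop) (l : Q → A), X = labelShift E l := by
  obtain ⟨m, Y, φ, hSFT, hφ, hcomm, rfl⟩ := hX
  obtain ⟨r₀, hr₀⟩ := exists_window_of_continuousOn (isClosed_of_isSFT hSFT) hφ
  obtain ⟨F, hF, hYF⟩ := hSFT
  have hmemY : ∀ y, y ∈ Y ↔ ∀ w ∈ F, ¬ Appears w y := fun y => by rw [hYF]; rfl
  have htr : ∀ (k : ℤ) {y}, y ∈ Y → (fun i => y (i + k)) ∈ Y := by
    intro k y hy
    rw [hmemY] at hy ⊢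
    exact fun w hw hap => hy w hw hap.translate
  have hcomm' : ∀ (k : ℤ) {y}, y ∈ Y → φ (fun i => y (i + k)) 0 = φ y k := by
    have hstep : ∀ (k : ℤ) {y}, y ∈ Y → ∀ j,
        φ (fun i => y (i + (k + 1))) j = φ (fun i => y (i + k)) (j + 1) := by
      intro k y hy j
      have := congrFun (hcomm _ (htr k hy)) j
      simp only [shiftMap] at this
      rw [← this]
      congr 2
      funext i
      simp only [shiftMap]
      congr 1
      ring
    have key : ∀ (k : ℤ) {y}, y ∈ Y → ∀ j, φ (fun i => y (i + k)) j = φ y (j + k) := by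
      intro k y hy
      induction k using Int.induction_on with
      | zero => simp
      | succ k ih =>
        intro j
        rw [hstep k hy, ih]
        congr 1
        ring
      | pred k ih =>
        intro j
        have := hstep (-(k : ℤ) - 1) hy (j - 1)
        rw [sub_add_cancel, sub_add_cancel, ih] at this
        rw [← this]
        congr 1
        ring
    intro k y hy
    simpa using key k hy 0
  let r : ℕ := max r₀ (hF.toFinset.sup List.length)
  have hr : ∀ y ∈ Y, ∀ z ∈ Y, (∀ i : ℤ, |i| ≤ r → z i = y i) → φ z 0 = φ y 0 :=
    fun y hy z hz h => hr₀ y hy z hz fun i hi =>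
      h i (hi.trans (by exact_mod_cast le_max_left _ _))
  have hlen : ∀ w ∈ F, w.length ≤ r := fun w hw =>
    (Finset.le_sup (f := List.length) (hF.mem_toFinset.2 hw)).trans (le_max_right _ _)
  let W := {j : ℤ // j ∈ Finset.Icc (-(r : ℤ)) r}
  let win : (ℤ → Fin m) → ℤ → W → Fin m := fun y k j => y (k + j.1)
  let Q := {q : W → Fin m // ∃ y ∈ Y, win y 0 = q}
  choose rep hrepY hrep using fun q : Q => q.2
  refine ⟨Q, inferInstance, fun p q => ∃ y ∈ Y, win y 0 = p.1 ∧ win y 1 = q.1,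
    fun q => φ (rep q) 0, ?_⟩
  ext x
  constructor
  · rintro ⟨y, hy, rfl⟩
    refine ⟨fun k => ⟨win y k, _, htr k hy, ?_⟩, fun k => ⟨_, htr k hy, ?_, ?_⟩, fun k => ?_⟩
    · funext j; simp only [win]; congr 1; ring
    · funext j; simp only [win]; congr 1; ring
    · funext j; simp only [win]; congr 1; ring
    · rw [← hcomm' k hy]
      refine hr _ (hrepY _) _ (htr k hy) fun i hi => ?_
      have := congrFun (hrep ⟨win y k, _, htr k hy, by
        funext j; simp only [win]; congr 1; ring⟩) ⟨i, Finset.mem_Icc.2 (abs_le.1 hi)⟩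
      simp only [win, zero_add] at this
      rw [this, add_comm]
  · rintro ⟨s, hs, hx⟩
    have h0 : (0 : ℤ) ∈ Finset.Icc (-(r : ℤ)) r := by simp
    have hshift : ∀ (k j : ℤ) (hj : j ∈ Finset.Icc (-(r : ℤ)) r)
        (hj' : j + 1 ∈ Finset.Icc (-(r : ℤ)) r), (s k).1 ⟨j + 1, hj'⟩ = (s (k + 1)).1 ⟨j, hj⟩ := by
      intro k j hj hj'
      obtain ⟨y, -, h1, h2⟩ := hs k
      rw [← h1, ← h2]
      simp only [win]
      congr 1
      ring
    have hpos : ∀ (n : ℕ) (k : ℤ) (hn : (n : ℤ) ∈ Finset.Icc (-(r : ℤ)) r),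
        (s k).1 ⟨n, hn⟩ = (s (k + n)).1 ⟨0, h0⟩ := by
      intro n
      induction n with
      | zero => intro k hn; simp
      | succ n ih =>
        intro k hn
        have hn' : (n : ℤ) ∈ Finset.Icc (-(r : ℤ)) r := by
          rw [Finset.mem_Icc] at hn ⊢; push_cast at hn; omega
        have h1 := hshift k n hn' (by simpa using hn)
        have h2 := ih (k + 1) hn'
        have h3 : k + ((n + 1 : ℕ) : ℤ) = k + 1 + n := by push_cast; ring
        rw [h3, ← h2, ← h1]
        rfl
    have hneg : ∀ (n : ℕ) (k : ℤ) (hn : -(n : ℤ) ∈ Finset.Icc (-(r : ℤ)) r),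
        (s k).1 ⟨-n, hn⟩ = (s (k - n)).1 ⟨0, h0⟩ := by
      intro n
      induction n with
      | zero => intro k hn; simp
      | succ n ih =>
        intro k hn
        have hn' : -(n : ℤ) ∈ Finset.Icc (-(r : ℤ)) r := by
          rw [Finset.mem_Icc] at hn ⊢; push_cast at hn; omega
        have h4 : -((n + 1 : ℕ) : ℤ) + 1 = -n := by push_cast; ring
        have h1 := hshift (k - 1) (-((n + 1 : ℕ) : ℤ)) hn (h4 ▸ hn')
        have h2 := ih (k - 1) hn'
        have h3 : k - ((n + 1 : ℕ) : ℤ) = k - 1 - n := by push_cast; ring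
        rw [sub_add_cancel] at h1
        rw [h3, ← h2, ← h1]
        simp only [h4]
    have hwin : ∀ (k j : ℤ) (hj : j ∈ Finset.Icc (-(r : ℤ)) r),
        (s k).1 ⟨j, hj⟩ = (s (k + j)).1 ⟨0, h0⟩ := by
      intro k j hj
      obtain ⟨n, rfl | rfl⟩ := j.eq_nat_or_neg
      · exact hpos n k hj
      · simpa [sub_eq_add_neg] using hneg n k hj
    have hrepwin : ∀ (k j : ℤ), |j| ≤ r → rep (s k) j = (s (k + j)).1 ⟨0, h0⟩ := by
      intro k j hj
      have hj' : j ∈ Finset.Icc (-(r : ℤ)) r := Finset.mem_Icc.2 (abs_le.1 hj)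
      rw [← hwin k j hj', ← hrep (s k)]
      simp [win]
    have hyY : (fun k => (s k).1 ⟨0, h0⟩) ∈ Y := by
      rw [hmemY]
      rintro w hw ⟨k, hk⟩
      have hmem := hrepY (s k)
      rw [hmemY] at hmem
      refine hmem w hw ⟨0, fun i => ?_⟩
      rw [← hk i, zero_add]
      refine hrepwin k _ ?_
      have := hlen w hw
      have := i.2
      rw [abs_of_nonneg (by positivity)]
      exact_mod_cast (by omega)
    refine ⟨_, hyY, funext fun k => ?_⟩
    rw [hx k, ← hcomm' k hyY]
    refine hr _ (hrepY _) _ (htr k hyY) fun i hi => ?_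
    rw [hrepwin k i hi, add_comm]

end Presentation

section Blocks

variable {V : Type*} {Adj : V → V → Prop} {S : V → Set ℕ}

/-- One step of a concatenation of blocks, where `(v, c)` stands for a position carrying the
letter `v` and preceded by exactly `c` letters of its block: either the block of `v` continues,
or it ends and a block of an out-neighbour of `v` begins. -/
def BlockStep (Adj : V → V → Prop) (S : V → Set ℕ) (p q : V × ℕ) : Prop :=
  (q.1 = p.1 ∧ q.2 = p.2 + 1) ∨ (q.2 = 0 ∧ Adj p.1 q.1 ∧ p.2 + 1 ∈ S p.1)

/-- A position from which the current block can be completed. -/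
def Completable (S : V → Set ℕ) (p : V × ℕ) : Prop := ∃ k, p.2 + k + 1 ∈ S p.1

theorem exists_counter_of_mem_SGraphCore {x : ℤ → V} (hx : x ∈ SGraphCore Adj S) :
    ∃ c : ℤ → ℕ, IsPath (BlockStep Adj S) (fun i => (x i, c i)) ∧ ∀ i, ∃ j, i ≤ j ∧ c j = 0 := by
  obtain ⟨a, t, ht, hS, hAdj, hxa, hcov⟩ := hx
  choose b hb hb' using hcov
  have huniq : ∀ i m, t i ≤ m → m < t (i + 1) → b m = i := by
    intro i m h1 h2
    have h3 := ht.lt_iff_lt.1 ((hb m).trans_lt h2)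
    have h4 := ht.lt_iff_lt.1 (h1.trans_lt (hb' m))
    omega
  have hzero : ∀ i, b (t i) = i := fun i => huniq i _ le_rfl (ht (lt_add_one i))
  refine ⟨fun m => (m - t (b m)).toNat, fun m => ?_, fun m => ⟨t (b m + 1), (hb' m).le, ?_⟩⟩
  · have h1 := hb m
    rcases lt_or_eq_of_le (Int.add_one_le_iff.2 (hb' m)) with h | h
    · have h2 := huniq (b m) (m + 1) (by omega) h
      refine Or.inl ⟨?_, ?_⟩
      · simp only
        rw [hxa _ _ (hb m) (hb' m), hxa _ _ (by omega) h]
      · simp only [h2]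
        omega
    · refine Or.inr ⟨?_, ?_, ?_⟩
      · simp only [h, hzero]
        simp
      · simp only
        rw [hxa _ _ (hb m) (hb' m), h, hxa _ _ le_rfl (ht (lt_add_one _))]
        exact hAdj _
      · have h2 := hS (b m)
        simp only
        rw [hxa _ _ (hb m) (hb' m)]
        convert h2 using 1
        omega
  · simp [hzero]

theorem mem_SGraphCore_of_counter {x : ℤ → V} {c : ℤ → ℕ}
    (hc : IsPath (BlockStep Adj S) fun i => (x i, c i)) (hreset : ∀ i, ∃ j, i ≤ j ∧ c j = 0) :
    x ∈ SGraphCore Adj S := by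
  classical
  have hback : ∀ (n : ℕ) (m : ℤ), c m = n → ∀ j : ℕ, j ≤ n → c (m - j) = n - j := by
    intro n
    induction n with
    | zero => intro m hm j hj; obtain rfl : j = 0 := by omega
              simpa using hm
    | succ n ih =>
      intro m hm j hj
      rcases j with _ | j
      · simpa using hm
      · rcases hc (m - 1) with h | h
        · have h2 := h.2
          simp only [sub_add_cancel] at h2
          have h3 := ih (m - 1) (by omega) j (by omega)
          rw [show m - ((j + 1 : ℕ) : ℤ) = m - 1 - j by push_cast; ring, h3]
          omega
        · have h2 := h.1
          simp only [sub_add_cancel] at h2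
          omega
  have hmark : ∀ m, c (m - c m) = 0 := fun m => by simpa using hback _ m rfl _ le_rfl
  let M := {j : ℤ // c j = 0}
  have : Nonempty M := ⟨⟨_, hmark 0⟩⟩
  have : NoMaxOrder M := ⟨fun p => by
    obtain ⟨j, hj, h⟩ := hreset (p.1 + 1)
    exact ⟨⟨j, h⟩, Subtype.coe_lt_coe.1 (by simp only; omega)⟩⟩
  have : NoMinOrder M := ⟨fun p =>
    ⟨⟨_, hmark (p.1 - 1)⟩, Subtype.coe_lt_coe.1 (by simp only; omega)⟩⟩
  let : LocallyFiniteOrder M := inferInstanceAs (LocallyFiniteOrder {j : ℤ // c j = 0})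
  let : SuccOrder M := LinearLocallyFiniteOrder.succOrder M
  let : PredOrder M := LinearLocallyFiniteOrder.predOrder M
  let e : M ≃o ℤ := orderIsoIntOfLinearSuccPredArch
  let t : ℤ → ℤ := fun i => (e.symm i).1
  have ht : StrictMono t := fun i j hij => e.symm.strictMono hij
  have ht0 : ∀ i, c (t i) = 0 := fun i => (e.symm i).2
  have hgap : ∀ i k, t i < k → k < t (i + 1) → c k ≠ 0 := by
    intro i k h1 h2 hk
    have e1 : i < e ⟨k, hk⟩ := e.symm_apply_lt.1 (Subtype.coe_lt_coe.1 h1)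
    have e2 : e ⟨k, hk⟩ < i + 1 := e.lt_symm_apply.1 (Subtype.coe_lt_coe.1 h2)
    omega
  have hrun : ∀ i k, t i ≤ k → k < t (i + 1) → (c k : ℤ) = k - t i ∧ x k = x (t i) := by
    intro i k hk
    induction k, hk using Int.leInduction with
    | base => intro _; simp [ht0]
    | succ k hk ih =>
      intro hk'
      obtain ⟨h1, h2⟩ := ih (by omega)
      rcases hc k with h | h
      · have h3 := h.1
        have h4 := h.2
        simp only at h3 h4
        exact ⟨by omega, h3.trans h2⟩
      · exact absurd h.1 (hgap i _ (by omega) hk')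
  have hend : ∀ i, Adj (x (t i)) (x (t (i + 1))) ∧ (t (i + 1) - t i).toNat ∈ S (x (t i)) := by
    intro i
    have hlt : t i < t (i + 1) := ht (lt_add_one i)
    obtain ⟨h1, h2⟩ := hrun i (t (i + 1) - 1) (by omega) (by omega)
    rcases hc (t (i + 1) - 1) with h | h
    · have h3 := h.2
      simp only [sub_add_cancel, ht0] at h3
      omega
    · have h3 := h.2
      simp only [sub_add_cancel, h2] at h3
      refine ⟨h3.1, ?_⟩
      convert h3.2 using 1
      omega
  refine ⟨fun i => x (t i), t, ht, fun i => (hend i).2, fun i => (hend i).1,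
    fun i k h1 h2 => (hrun i k h1 h2).2, fun m => ⟨e ⟨_, hmark m⟩, ?_, ?_⟩⟩
  · simp [t]
  · by_contra! hle
    have hlt : t (e ⟨_, hmark m⟩) < t (e ⟨_, hmark m⟩ + 1) := ht (lt_add_one _)
    have h1 : t (e ⟨_, hmark m⟩) = m - c m := by simp [t]
    have h2 := hback _ m rfl (m - t (e ⟨_, hmark m⟩ + 1)).toNat (by omega)
    rw [show m - ((m - t (e ⟨_, hmark m⟩ + 1)).toNat : ℤ) = t (e ⟨_, hmark m⟩ + 1) by omega,
      ht0] at h2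
    omega

theorem exists_right_ray (hout : ∀ v, ∃ w, Adj v w) (hNe : ∀ v, (S v).Nonempty)
    (hPos : ∀ v, 0 ∉ S v) {p : V × ℕ} (hp : Completable S p) :
    ∃ f : ℕ → V × ℕ, f 0 = p ∧ (∀ n, BlockStep Adj S (f n) (f (n + 1))) ∧
      ∀ n, ∃ m, n ≤ m ∧ (f m).2 = 0 := by
  classical
  choose next hnext using hout
  let R : V × ℕ → V × ℕ := fun p => if p.2 + 1 ∈ S p.1 then (next p.1, 0) else (p.1, p.2 + 1)
  have hstep : ∀ p, BlockStep Adj S p (R p) := by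
    intro p
    by_cases h : p.2 + 1 ∈ S p.1
    · simp [R, h, BlockStep, hnext]
    · simp [R, h, BlockStep]
  have hcomp : ∀ p, Completable S p → Completable S (R p) := by
    rintro p ⟨k, hk⟩
    by_cases h : p.2 + 1 ∈ S p.1
    · obtain ⟨n, hn⟩ := hNe (next p.1)
      have hn0 : n ≠ 0 := fun h0 => hPos _ (h0 ▸ hn)
      refine ⟨n - 1, ?_⟩
      simp only [R, h, if_true]
      convert hn using 1
      omega
    · rcases k with _ | k
      · exact absurd hk h
      · refine ⟨k, ?_⟩
        simp only [R, h, if_false]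
        convert hk using 1
        omega
  have hreset : ∀ k p, p.2 + k + 1 ∈ S p.1 → ∃ j, (R^[j] p).2 = 0 := by
    intro k
    induction k with
    | zero => intro p hk; exact ⟨1, by simp [R, show p.2 + 1 ∈ S p.1 from hk]⟩
    | succ k ih =>
      intro p hk
      by_cases h : p.2 + 1 ∈ S p.1
      · exact ⟨1, by simp [R, h]⟩
      · obtain ⟨j, hj⟩ := ih (R p) (by
          simp only [R, h, if_false]
          convert hk using 1
          omega)
        exact ⟨j + 1, hj⟩
  refine ⟨fun n => R^[n] p, rfl, fun n => ?_, fun n => ?_⟩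
  · simpa only [Function.iterate_succ_apply'] using hstep _
  · have hn : Completable S (R^[n] p) := by
      induction n with
      | zero => exact hp
      | succ n ih => simpa only [Function.iterate_succ_apply'] using hcomp _ ih
    obtain ⟨k, hk⟩ := hn
    obtain ⟨j, hj⟩ := hreset k _ hk
    exact ⟨j + n, by omega, by simpa only [Function.iterate_add_apply] using hj⟩

theorem exists_left_ray (hin : ∀ v, ∃ u, Adj u v) (hNe : ∀ v, (S v).Nonempty)
    (hPos : ∀ v, 0 ∉ S v) (p : V × ℕ) :
    ∃ f : ℕ → V × ℕ, f 0 = p ∧ ∀ n, BlockStep Adj S (f (n + 1)) (f n) := by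
  have hprev : ∀ q : V × ℕ, ∃ p, BlockStep Adj S p q := by
    rintro ⟨v, _ | c⟩
    · obtain ⟨u, hu⟩ := hin v
      obtain ⟨n, hn⟩ := hNe u
      have hn0 : n ≠ 0 := fun h0 => hPos _ (h0 ▸ hn)
      exact ⟨(u, n - 1), Or.inr ⟨rfl, hu, by rwa [Nat.sub_add_cancel (by omega)]⟩⟩
    · exact ⟨(v, c), Or.inl ⟨rfl, rfl⟩⟩
  choose L hL using hprev
  exact ⟨fun n => L^[n] p, rfl, fun n => by
    simpa only [Function.iterate_succ_apply'] using hL _⟩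

/-- A finite path of block steps ending in a completable position extends to a point of the
core. -/
theorem exists_mem_SGraphCore_of_path (hEss : ∀ v : V, (∃ u, Adj u v) ∧ (∃ w, Adj v w))
    (hNe : ∀ v, (S v).Nonempty) (hPos : ∀ v, 0 ∉ S v) (p : ℤ → V × ℕ) {a b : ℤ} (hab : a ≤ b)
    (hp : ∀ i, a ≤ i → i < b → BlockStep Adj S (p i) (p (i + 1))) (hb : Completable S (p b)) :
    ∃ x ∈ SGraphCore Adj S, ∀ i, a ≤ i → i ≤ b → x i = (p i).1 := by
  obtain ⟨f, hf0, hf, hfr⟩ := exists_right_ray (fun v => (hEss v).2) hNe hPos hb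
  obtain ⟨g, hg0, hg⟩ := exists_left_ray (fun v => (hEss v).1) hNe hPos (p a)
  let q : ℤ → V × ℕ := fun i =>
    if i < a then g (a - i).toNat else if i ≤ b then p i else f (i - b).toNat
  have hqp : ∀ i, a ≤ i → i ≤ b → q i = p i := fun i h1 h2 => by simp [q, not_lt.2 h1, h2]
  have hqg : ∀ i, i ≤ a → q i = g (a - i).toNat := by
    intro i hi
    rcases hi.lt_or_eq with h | rfl
    · simp [q, h]
    · simp [q, hab, hg0]
  have hqf : ∀ i, b ≤ i → q i = f (i - b).toNat := by
    intro i hi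
    rcases hi.lt_or_eq with h | rfl
    · simp [q, not_lt.2 (hab.trans hi), not_le.2 h]
    · simp [q, not_lt.2 hab, hf0]
  refine ⟨fun i => (q i).1, mem_SGraphCore_of_counter (c := fun i => (q i).2) ?_ ?_,
    fun i h1 h2 => by simp only [hqp i h1 h2]⟩
  · intro i
    change BlockStep Adj S (q i) (q (i + 1))
    rcases lt_or_ge i a with h | h
    · rw [hqg i h.le, hqg (i + 1) (by omega)]
      convert hg (a - (i + 1)).toNat using 2
      omega
    · rcases lt_or_ge i b with h' | h'
      · rw [hqp i h h'.le, hqp (i + 1) (by omega) (by omega)]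
        exact hp i h h'
      · rw [hqf i h', hqf (i + 1) (by omega)]
        convert hf (i - b).toNat using 2
        omega
  · intro i
    obtain ⟨m, hm, h0⟩ := hfr (i - b).toNat
    refine ⟨b + m, by omega, ?_⟩
    rw [hqf _ (by omega)]
    convert h0 using 3
    omega

theorem completable_of_counter {x : ℤ → V} {c : ℤ → ℕ}
    (hc : IsPath (BlockStep Adj S) fun i => (x i, c i)) (hreset : ∀ i, ∃ j, i ≤ j ∧ c j = 0)
    (i : ℤ) : Completable S (x i, c i) := by
  have key : ∀ (n : ℕ) (i : ℤ), c (i + n + 1) = 0 → Completable S (x i, c i) := by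
    intro n
    induction n with
    | zero =>
      intro i hi
      rcases hc i with h | h
      · have := h.2
        simp only [Nat.cast_zero, add_zero] at this hi
        omega
      · exact ⟨0, h.2.2⟩
    | succ n ih =>
      intro i hi
      rcases hc i with h | h
      · obtain ⟨k, hk⟩ := ih (i + 1) (by convert hi using 2; push_cast; ring)
        have h1 := h.1
        have h2 := h.2
        simp only at h1 h2 hk
        refine ⟨k + 1, ?_⟩
        rw [h1, h2] at hk
        simp only
        convert hk using 1
        omega
      · exact ⟨0, h.2.2⟩
  obtain ⟨j, hj, h0⟩ := hreset (i + 1)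
  exact key (j - (i + 1)).toNat i (by convert h0 using 2; omega)

/-- The word `u v^n w` occurs at the origin of a point of the shift exactly when `n ∈ S v`. -/
theorem mem_iff_exists_block [TopologicalSpace V] [DiscreteTopology V]
    (hLoop : ∀ v, ¬ Adj v v) (hEss : ∀ v : V, (∃ u, Adj u v) ∧ (∃ w, Adj v w))
    (hNe : ∀ v, (S v).Nonempty) (hPos : ∀ v, 0 ∉ S v) {u v w : V} (huv : Adj u v)
    (hvw : Adj v w) {n : ℕ} (hn : 1 ≤ n) :
    n ∈ S v ↔ ∃ x ∈ closure (SGraphCore Adj S),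
      x 0 = u ∧ (∀ i : ℤ, 1 ≤ i → i ≤ n → x i = v) ∧ x (n + 1) = w := by
  constructor
  · intro hnS
    obtain ⟨k, hk⟩ := hNe u
    have hk0 : k ≠ 0 := fun h0 => hPos _ (h0 ▸ hk)
    obtain ⟨l, hl⟩ := hNe w
    have hl0 : l ≠ 0 := fun h0 => hPos _ (h0 ▸ hl)
    let p : ℤ → V × ℕ := fun i =>
      if i ≤ 0 then (u, k - 1) else if i ≤ n then (v, (i - 1).toNat) else (w, 0)
    have hp0 : p 0 = (u, k - 1) := by simp [p]
    have hpv : ∀ i : ℤ, 1 ≤ i → i ≤ n → p i = (v, (i - 1).toNat) := fun i h1 h2 => by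
      simp [p, show ¬ i ≤ 0 by omega, h2]
    have hpw : p (n + 1) = (w, 0) := by
      simp [p, show ¬ (n : ℤ) + 1 ≤ 0 by omega]
    obtain ⟨x, hx, hxp⟩ := exists_mem_SGraphCore_of_path hEss hNe hPos p (a := 0) (b := n + 1)
      (by omega) (by
        intro i h1 h2
        rcases h1.eq_or_lt with rfl | h1
        · rw [hp0, hpv _ (by omega) (by omega)]
          exact Or.inr ⟨rfl, huv, by rwa [Nat.sub_add_cancel (by omega)]⟩
        · rcases (Int.lt_add_one_iff.1 h2).eq_or_lt with rfl | h2
          · rw [hpv _ (by omega) le_rfl, hpw]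
            refine Or.inr ⟨rfl, hvw, ?_⟩
            simp only
            convert hnS using 1
            omega
          · rw [hpv _ (by omega) (by omega), hpv _ (by omega) (by omega)]
            refine Or.inl ⟨rfl, ?_⟩
            simp only
            omega)
      (by
        rw [hpw]
        exact ⟨l - 1, by simp only; convert hl using 1; omega⟩)
    refine ⟨x, subset_closure hx, ?_, fun i h1 h2 => ?_, ?_⟩
    · rw [hxp 0 le_rfl (by omega), hp0]
    · rw [hxp i (by omega) (by omega), hpv i h1 h2]
    · rw [hxp _ (by omega) le_rfl, hpw]
  · rintro ⟨x', hx', hu', hv', hw'⟩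
    obtain ⟨x, hx, hxx'⟩ := mem_closure_iff_forall_window.1 hx' (n + 1)
    have hx0 : x 0 = u := (hxx' 0 (by simp; omega)).trans hu'
    have hxv : ∀ i : ℤ, 1 ≤ i → i ≤ n → x i = v := fun i h1 h2 =>
      (hxx' i (by rw [abs_of_nonneg (by omega)]; push_cast; omega)).trans (hv' i h1 h2)
    have hxw : x (n + 1) = w :=
      (hxx' _ (by rw [abs_of_nonneg (by omega)]; push_cast; omega)).trans hw'
    obtain ⟨c, hc, -⟩ := exists_counter_of_mem_SGraphCore hx
    have hcount : ∀ i : ℤ, 1 ≤ i → i ≤ n → (c i : ℤ) = i - 1 := by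
      intro i hi
      induction i, hi using Int.leInduction with
      | base =>
        intro h1
        rcases hc 0 with h | h
        · have h2 := h.1
          simp only [zero_add] at h2
          rw [hx0, hxv 1 le_rfl h1] at h2
          exact absurd (h2 ▸ huv) (hLoop _)
        · simpa using h.1
      | succ i hi ih =>
        intro h1
        have h2 := ih (by omega)
        rcases hc i with h | h
        · have h3 := h.2
          simp only at h3
          omega
        · have h3 := h.2.1
          simp only at h3
          rw [hxv i hi (by omega), hxv (i + 1) (by omega) h1] at h3
          exact absurd h3 (hLoop _)
    have h1 := hcount n (by omega) le_rfl
    have h2 := hxv n (by omega) le_rfl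
    rcases hc n with h | h
    · have h3 := h.1
      simp only at h3
      rw [hxw, h2] at h3
      exact absurd (h3 ▸ hvw) (hLoop _)
    · have h3 := h.2.2
      simp only [h2] at h3
      convert h3 using 1
      omega

end Blocks

theorem deltaEventuallyPeriodic_of_labelShift {V Q : Type*} [Finite Q] {T : Set ℕ}
    {E : Q → Q → Prop} {l : Q → V} {u v w : V}
    (hT : ∀ n : ℕ, 1 ≤ n → (n ∈ T ↔ ∃ x ∈ labelShift E l,
      x 0 = u ∧ (∀ i : ℤ, 1 ≤ i → i ≤ n → x i = v) ∧ x (n + 1) = w)) :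
    DeltaEventuallyPeriodic T := by
  let A : ℕ → Set Q := fun n => {q | ∃ s, IsPath E s ∧ l (s 0) = u ∧
    (∀ i : ℤ, 1 ≤ i → i ≤ n → l (s i) = v) ∧ s n = q}
  let step : Set Q → Set Q := fun B => {q | ∃ s, IsPath E s ∧ s 0 ∈ B ∧ s 1 = q ∧ l q = v}
  have hglue : ∀ (n : ℕ) s, IsPath E s → s 0 ∈ A n → ∃ s', IsPath E s' ∧ l (s' 0) = u ∧
      (∀ i : ℤ, 1 ≤ i → i ≤ n → l (s' i) = v) ∧ s' (n + 1) = s 1 := by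
    rintro n s hs ⟨s₀, hs₀, hu, hv, hn⟩
    refine ⟨_, hs₀.glue (hs.translate (-n)) (n := n) (by simpa using hn), ?_, ?_, ?_⟩
    · simpa using hu
    · intro i h1 h2
      simpa [h2] using hv i h1 h2
    · simp
  have hAsucc : ∀ n, A (n + 1) = step (A n) := by
    intro n
    ext q
    constructor
    · rintro ⟨s, hs, hu, hv, hq⟩
      refine ⟨_, hs.translate n, ⟨s, hs, hu, fun i h1 h2 => hv i h1 (by push_cast; omega), ?_⟩,
        ?_, ?_⟩
      · simp
      · rw [← hq]; push_cast; rw [add_comm]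
      · rw [← hq]; exact hv _ (by push_cast; omega) le_rfl
    · rintro ⟨s, hs, hA, hq, hl⟩
      obtain ⟨s', hs', hu, hv, hn⟩ := hglue n s hs hA
      refine ⟨s', hs', hu, fun i h1 h2 => ?_, by push_cast; exact hn.trans hq⟩
      rcases h2.lt_or_eq with h | rfl
      · exact hv i h1 (by push_cast at h; omega)
      · push_cast
        rw [hn, hq, hl]
  have hmem : ∀ n : ℕ, 1 ≤ n → (n ∈ T ↔ ∃ s, IsPath E s ∧ s 0 ∈ A n ∧ l (s 1) = w) := by
    intro n hn
    rw [hT n hn]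
    constructor
    · rintro ⟨x, ⟨s, hs, hx⟩, hu, hv, hw⟩
      simp only [hx] at hu hv hw
      exact ⟨_, hs.translate n, ⟨s, hs, hu, hv, by simp⟩, by rwa [add_comm]⟩
    · rintro ⟨s, hs, hA, hw⟩
      obtain ⟨s', hs', hu, hv, hn⟩ := hglue n s hs hA
      exact ⟨fun i => l (s' i), ⟨s', hs', fun _ => rfl⟩, hu, hv, by simp only [hn, hw]⟩
  obtain ⟨i, j, hij, hA⟩ : ∃ i j, i < j ∧ A i = A j := by
    obtain ⟨i, j, hne, h⟩ := Finite.exists_ne_map_eq_of_infinite A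
    rcases hne.lt_or_gt with h' | h'
    · exact ⟨i, j, h', h⟩
    · exact ⟨j, i, h', h.symm⟩
  have hper : ∀ k, A (i + k) = A (j + k) := by
    intro k
    induction k with
    | zero => exact hA
    | succ k ih => rw [← add_assoc, ← add_assoc, hAsucc, hAsucc, ih]
  refine ⟨j - i, by omega, i + 1, fun n hn => ?_⟩
  have h := hper (n - i)
  rw [show i + (n - i) = n by omega, show j + (n - i) = n + (j - i) by omega] at h
  rw [hmem n (by omega), hmem (n + (j - i)) (by omega), h]

/-- The residualSet of `T` after `c`: the lengths completing `c` to an element of `T`. -/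
def residualSet (T : Set ℕ) (c : ℕ) : Set ℕ := {n | c + n ∈ T}

theorem finite_range_residual {T : Set ℕ} (hT : DeltaEventuallyPeriodic T) :
    (Set.range (residualSet T)).Finite := by
  obtain ⟨d, hd, N, hN⟩ := hT
  refine ((Set.finite_lt_nat (N + d)).image (residualSet T)).subset ?_
  rintro _ ⟨c, rfl⟩
  induction c using Nat.strong_induction_on with
  | _ c ih =>
    by_cases h : c < N + d
    · exact ⟨c, h, rfl⟩
    · have hc : residualSet T c = residualSet T (c - d) := by
        ext n
        have := hN (c - d + n) (by omega)
        rw [show c - d + n + d = c + n by omega] at this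
        exact this.symm
      rw [hc]
      exact ih _ (by omega)

section Residual

variable {V : Type*} {Adj : V → V → Prop} {S : V → Set ℕ}

/-- The state of a position: its letter and the residualSet of its counter. -/
def blockState (S : V → Set ℕ) (p : V × ℕ) : V × Set ℕ := (p.1, residualSet (S p.1) p.2)

theorem finite_range_blockState [Finite V] (hS : ∀ v, DeltaEventuallyPeriodic (S v)) :
    (Set.range (blockState S)).Finite := by
  refine (Set.finite_iUnion fun v =>
    ((finite_range_residual (hS v)).image (Prod.mk v))).subset ?_
  rintro _ ⟨⟨v, c⟩, rfl⟩
  exact Set.mem_iUnion.2 ⟨v, _, ⟨c, rfl⟩, rfl⟩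

theorem BlockStep.lift {p q p' : V × ℕ} (h : BlockStep Adj S p q)
    (hpp' : blockState S p' = blockState S p) :
    ∃ q', BlockStep Adj S p' q' ∧ blockState S q' = blockState S q := by
  obtain ⟨v, c⟩ := p
  obtain ⟨v', c'⟩ := p'
  obtain ⟨w, d⟩ := q
  simp only [blockState, Prod.mk.injEq] at hpp'
  obtain ⟨rfl, hres⟩ := hpp'
  have hres' : ∀ n, c' + n ∈ S v' ↔ c + n ∈ S v' := fun n => Set.ext_iff.1 hres n
  rcases h with ⟨h1, h2⟩ | ⟨h1, h2, h3⟩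
  · simp only at h1 h2
    subst h1 h2
    refine ⟨(w, c' + 1), Or.inl ⟨rfl, rfl⟩, Prod.ext rfl (Set.ext fun n => ?_)⟩
    have := hres' (1 + n)
    rwa [← add_assoc, ← add_assoc] at this
  · exact ⟨(w, d), Or.inr ⟨h1, h2, (hres' 1).2 h3⟩, rfl⟩

theorem completable_of_blockState_eq {p q : V × ℕ} (h : blockState S p = blockState S q)
    (hq : Completable S q) : Completable S p := by
  obtain ⟨k, hk⟩ := hq
  have h1 := congrArg Prod.fst h
  have h2 := Set.ext_iff.1 (congrArg Prod.snd h) (k + 1)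
  refine ⟨k, ?_⟩
  simp only [blockState, residualSet, Set.mem_ofPred_eq] at h1 h2
  exact h2.2 hk

/-- The transition relation induced on states by block steps into completable positions. -/
def stateStep (Adj : V → V → Prop) (S : V → Set ℕ) (p q : Set.range (blockState S)) : Prop :=
  ∃ p' q', BlockStep Adj S p' q' ∧ Completable S q' ∧ blockState S p' = p ∧ blockState S q' = q

theorem SGraphCore_subset_labelShift :
    SGraphCore Adj S ⊆ labelShift (stateStep Adj S) fun q => q.1.1 := by
  intro x hx
  obtain ⟨c, hc, hreset⟩ := exists_counter_of_mem_SGraphCore hx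
  exact ⟨fun i => ⟨_, (x i, c i), rfl⟩, fun i =>
    ⟨_, _, hc i, completable_of_counter hc hreset _, rfl, rfl⟩, fun i => rfl⟩

theorem labelShift_subset_closure [TopologicalSpace V] [DiscreteTopology V]
    (hEss : ∀ v : V, (∃ u, Adj u v) ∧ (∃ w, Adj v w))
    (hNe : ∀ v, (S v).Nonempty) (hPos : ∀ v, 0 ∉ S v) :
    labelShift (stateStep Adj S) (fun q => q.1.1) ⊆ closure (SGraphCore Adj S) := by
  rintro x ⟨s, hs, hx⟩
  refine mem_closure_iff_forall_window.2 fun r => ?_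
  have hlift : ∀ (i : ℤ) (p : V × ℕ), blockState S p = (s i).1 →
      ∃ q, BlockStep Adj S p q ∧ blockState S q = (s (i + 1)).1 := by
    intro i p hp
    obtain ⟨p', q', hstep, -, hp', hq'⟩ := hs i
    obtain ⟨q, hq, hqq'⟩ := hstep.lift (hp.trans hp'.symm)
    exact ⟨q, hq, hqq'.trans hq'⟩
  choose! next hnext hstate using hlift
  obtain ⟨p₀, hp₀⟩ := (s (-r)).2
  let f : ℕ → V × ℕ := fun n => Nat.rec p₀ (fun n p => next (-r + n) p) n
  have hf : ∀ n : ℕ, blockState S (f n) = (s (-r + n)).1 := by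
    intro n
    induction n with
    | zero => rw [Nat.cast_zero, add_zero]; exact hp₀
    | succ n ih =>
      have := hstate _ _ ih
      push_cast
      rwa [← add_assoc]
  have hfr : Completable S (f (2 * r)) := by
    obtain ⟨p', q', -, hcomp, -, hq'⟩ := hs (r - 1)
    refine completable_of_blockState_eq ((hf _).trans (Eq.trans ?_ hq'.symm)) hcomp
    congr 2
    push_cast
    ring
  obtain ⟨z, hz, hzx⟩ := exists_mem_SGraphCore_of_path hEss hNe hPos
    (fun i => f (i + r).toNat) (a := -r) (b := r) (by omega) (by
      intro i h1 h2
      have := hnext _ _ (hf (i + r).toNat)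
      rw [show (i + 1 + r).toNat = (i + r).toNat + 1 by omega]
      exact this) (by
      convert hfr using 2
      omega)
  refine ⟨z, hz, fun i hi => ?_⟩
  obtain ⟨h1, h2⟩ := abs_le.1 hi
  rw [hzx i h1 h2, hx i]
  have := congrArg Prod.fst (hf (i + r).toNat)
  rw [show -(r : ℤ) + (i + r).toNat = i by omega] at this
  exact this

end Residual

/-- **Sofic characterization.**  Let `(G,S)` be an essential set-equipped graph.
`X(G,S)` is sofic iff `Δ(S_v)` is eventually periodic for every vertex `v`. -/
theorem isSofic_SGraphShift_iff {V : Type*} [Fintype V]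
    [TopologicalSpace V] [DiscreteTopology V]
    (Adj : V → V → Prop) (S : V → Set ℕ)
    (hLoop : ∀ v, ¬ Adj v v)
    (hNe : ∀ v, (S v).Nonempty) (hPos : ∀ v, 0 ∉ S v)
    (hEss : ∀ v : V, (∃ u, Adj u v) ∧ (∃ w, Adj v w)) :
    IsSofic (closure (SGraphCore Adj S)) ↔ ∀ v, DeltaEventuallyPeriodic (S v) := by
  constructor
  · intro h v
    obtain ⟨⟨u, huv⟩, w, hvw⟩ := hEss v
    obtain ⟨Q, _, E, l, hX⟩ := h.exists_labelShift
    refine deltaEventuallyPeriodic_of_labelShift (E := E) (l := l) (u := u) (v := v) (w := w)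
      fun n hn => ?_
    rw [mem_iff_exists_block hLoop hEss hNe hPos huv hvw hn, hX]
  · intro h
    have : Finite (Set.range (blockState S)) := finite_range_blockState h
    have hsofic := isSofic_labelShift (stateStep Adj S) fun q => q.1.1
    rwa [Set.Subset.antisymm (closure_minimal SGraphCore_subset_labelShift hsofic.isClosed)
      (labelShift_subset_closure hEss hNe hPos)]
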